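/- There is an absolute constant C > 0 with the following property. For every weighted directed graph G = (V,E,W) with n ≥ 2 vertices, every source vertex set S ⊆ V of size s ≥ 2, and every integer k > 1, there exists a subgraph H of G with at most C·n·s^{1/k}·(log n)^2 edges such that H is an S-sourcewise (C·k·log n)-roundtrip spanner of G. -/

import Mathlib

open scoped ENNReal

noncomputable section

/-- The cost (total weight) of a walk, given as a list of consecutively visited
vertices, where weights are coerced into `ℝ≥0∞`. -/
def walkCost {V : Type*} (W : V × V → ℝ) : List V → ℝ≥0∞
  | [] => 0
  | [_] => 0
  | a :: b :: l => ENNReal.ofReal (W (a, b)) + walkCost W (b :: l)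

/-- `l` is (the list of vertices of) a directed walk from `u` to `v` in the
digraph with edge set `E`. -/
def IsWalk {V : Type*} (E : Set (V × V)) (u v : V) (l : List V) : Prop :=
  l.Chain' (fun a b => (a, b) ∈ E) ∧ l.head? = some u ∧ l.getLast? = some v

/-- The shortest-path distance from `u` to `v` in the digraph with edge set `E`
and weight function `W` (equal to `∞` if there is no directed path). -/
def gdist {V : Type*} (E : Set (V × V)) (W : V × V → ℝ) (u v : V) : ℝ≥0∞ :=
  ⨅ (l : List V) (_ : IsWalk E u v l), walkCost W l

/-- The round-trip distance between `u` and `v`. -/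
def rtdist {V : Type*} (E : Set (V × V)) (W : V × V → ℝ) (u v : V) : ℝ≥0∞ :=
  gdist E W u v + gdist E W v u


section Distances

variable {V : Type*} {E F : Set (V × V)} {W : V × V → ℝ}

theorem gdist_self (E : Set (V × V)) (W : V × V → ℝ) (u : V) : gdist E W u u = 0 := by
  refine le_antisymm (iInf₂_le_of_le [u] ⟨?_, rfl, rfl⟩ le_rfl) zero_le
  exact List.isChain_singleton u

theorem gdist_le_edge_add {a b : V} (h : (a, b) ∈ E) (v : V) :
    gdist E W a v ≤ ENNReal.ofReal (W (a, b)) + gdist E W b v := by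
  unfold gdist
  rw [ENNReal.add_iInf]
  refine le_iInf fun l => ?_
  by_cases hl : IsWalk E b v l
  · obtain ⟨hc, hh, ht⟩ := hl
    cases l with
    | nil => simp at hh
    | cons c l =>
      obtain rfl : c = b := by simpa using hh
      have hw : IsWalk E a v (a :: c :: l) :=
        ⟨List.isChain_cons_cons.2 ⟨h, hc⟩, rfl, by simpa [List.getLast?_cons_cons] using ht⟩
      refine (iInf₂_le (a :: c :: l) hw).trans ?_
      simp only [walkCost]
      gcongr
      exact le_iInf fun _ => le_rfl
  · simp [hl]

/-- A function that is 1-Lipschitz along the edges is 1-Lipschitz for the distance. -/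
theorem le_gdist_add_of_edge {φ : V → ℝ≥0∞}
    (hφ : ∀ a b, (a, b) ∈ E → φ a ≤ ENNReal.ofReal (W (a, b)) + φ b) (u v : V) :
    φ u ≤ gdist E W u v + φ v := by
  have key : ∀ (l : List V) (u : V), IsWalk E u v l → φ u ≤ walkCost W l + φ v := by
    intro l
    induction l with
    | nil => rintro u ⟨-, hh, -⟩; simp at hh
    | cons c l ih =>
      rintro u ⟨hc, hh, ht⟩
      obtain rfl : c = u := by simpa using hh
      cases l with
      | nil =>
        obtain rfl : c = v := by simpa using ht
        simp [walkCost]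
      | cons d l =>
        obtain ⟨h1, h2⟩ := List.isChain_cons_cons.1 hc
        have := ih d ⟨h2, rfl, by simpa [List.getLast?_cons_cons] using ht⟩
        simp only [walkCost]
        rw [add_assoc]
        exact (hφ c d h1).trans (by gcongr)
  unfold gdist
  rw [ENNReal.iInf_add]
  refine le_iInf fun l => ?_
  by_cases hl : IsWalk E u v l
  · simpa [hl] using key l u hl
  · simp [hl]

theorem gdist_triangle (E : Set (V × V)) (W : V × V → ℝ) (u v w : V) :
    gdist E W u w ≤ gdist E W u v + gdist E W v w :=
  le_gdist_add_of_edge (φ := fun a => gdist E W a w) (fun _ _ h => gdist_le_edge_add h w) u v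

theorem gdist_edge {a b : V} (h : (a, b) ∈ E) : gdist E W a b ≤ ENNReal.ofReal (W (a, b)) := by
  simpa [gdist_self] using gdist_le_edge_add (W := W) h b

theorem gdist_anti (h : E ⊆ F) (u v : V) : gdist F W u v ≤ gdist E W u v := by
  simpa [gdist_self] using le_gdist_add_of_edge (E := E) (W := W)
    (φ := fun a => gdist F W a v) (fun _ _ hab => gdist_le_edge_add (h hab) v) u v

theorem rtdist_anti (h : E ⊆ F) (u v : V) : rtdist F W u v ≤ rtdist E W u v :=
  add_le_add (gdist_anti h u v) (gdist_anti h v u)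

theorem rtdist_self (E : Set (V × V)) (W : V × V → ℝ) (u : V) : rtdist E W u u = 0 := by
  simp [rtdist, gdist_self]

theorem rtdist_comm (E : Set (V × V)) (W : V × V → ℝ) (u v : V) :
    rtdist E W u v = rtdist E W v u := add_comm _ _

theorem rtdist_triangle (E : Set (V × V)) (W : V × V → ℝ) (u v w : V) :
    rtdist E W u w ≤ rtdist E W u v + rtdist E W v w := by
  unfold rtdist
  calc _ ≤ (gdist E W u v + gdist E W v w) + (gdist E W w v + gdist E W v u) :=
        add_le_add (gdist_triangle ..) (gdist_triangle ..)
    _ = _ := by ring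

theorem exists_pred [Finite V] {u v : V} (huv : u ≠ v) (h : gdist E W u v ≠ ⊤) :
    ∃ p, (p, v) ∈ E ∧ gdist E W u p + ENNReal.ofReal (W (p, v)) ≤ gdist E W u v := by
  classical
  let f : V → V → ℝ≥0∞ := fun a p =>
    if (p, v) ∈ E then gdist E W a p + ENNReal.ofReal (W (p, v)) else ⊤
  have hle : (⨅ p, f u p) ≤ gdist E W u v := by
    have := le_gdist_add_of_edge (E := E) (W := W)
      (φ := fun a => if a = v then 0 else ⨅ p, f a p) ?_ u v
    · simpa [huv] using this
    · intro a b hab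
      by_cases ha : a = v
      · simp [ha]
      by_cases hb : b = v
      · subst hb
        simp only [ha, if_false, if_true, add_zero]
        exact iInf_le_of_le a (by simp [f, hab, gdist_self])
      · simp only [ha, hb, if_false]
        rw [ENNReal.add_iInf]
        refine iInf_mono fun p => ?_
        by_cases hp : (p, v) ∈ E
        · simp only [f, hp, if_true]
          rw [← add_assoc]
          gcongr
          exact gdist_le_edge_add hab p
        · simp [f, hp]
  have : Nonempty V := ⟨u⟩
  obtain ⟨p, hp⟩ := exists_eq_ciInf_of_finite (f := f u)
  rw [← hp] at hle
  by_cases hpE : (p, v) ∈ E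
  · exact ⟨p, hpE, by simpa [f, hpE] using hle⟩
  · simp [f, hpE] at hle
    exact absurd hle h

theorem exists_succ [Finite V] {u v : V} (huv : u ≠ v) (h : gdist E W u v ≠ ⊤) :
    ∃ p, (u, p) ∈ E ∧ ENNReal.ofReal (W (u, p)) + gdist E W p v ≤ gdist E W u v := by
  classical
  let f : V → V → ℝ≥0∞ := fun a p =>
    if (a, p) ∈ E then ENNReal.ofReal (W (a, p)) + gdist E W p v else ⊤
  have hf : ∀ a, gdist E W a v ≤ ⨅ p, f a p := fun a => le_iInf fun p => by
    by_cases hp : (a, p) ∈ E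
    · simpa [f, hp] using gdist_le_edge_add hp v
    · simp [f, hp]
  have hle : (⨅ p, f u p) ≤ gdist E W u v := by
    have := le_gdist_add_of_edge (E := E) (W := W)
      (φ := fun a => if a = v then 0 else ⨅ p, f a p) ?_ u v
    · simpa [huv] using this
    · intro a b hab
      by_cases ha : a = v
      · simp [ha]
      simp only [ha, if_false]
      have h1 : (⨅ p, f a p) ≤ ENNReal.ofReal (W (a, b)) + gdist E W b v :=
        iInf_le_of_le b (by simp [f, hab])
      refine h1.trans ?_
      gcongr
      by_cases hb : b = v
      · simp [hb, gdist_self]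
      · simpa [hb] using hf b
  have : Nonempty V := ⟨u⟩
  obtain ⟨p, hp⟩ := exists_eq_ciInf_of_finite (f := f u)
  rw [← hp] at hle
  by_cases hpE : (u, p) ∈ E
  · exact ⟨p, hpE, by simpa [f, hpE] using hle⟩
  · simp [f, hpE] at hle
    exact absurd hle h

theorem gdist_pos [Finite V] (hW : ∀ e ∈ E, 0 < W e) {u v : V} (huv : u ≠ v) :
    0 < gdist E W u v := by
  by_cases h : gdist E W u v = ⊤
  · simp [h]
  · obtain ⟨p, hp, hle⟩ := exists_pred huv h
    exact (ENNReal.ofReal_pos.2 (hW _ hp)).trans_le (le_add_self.trans hle)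

theorem lt_of_add_ofReal_le {a b : ℝ≥0∞} {w : ℝ} (hw : 0 < w) (hb : b ≠ ⊤)
    (h : a + ENNReal.ofReal w ≤ b) : a < b := by
  have ha : a ≠ ⊤ := ne_top_of_le_ne_top hb (le_self_add.trans h)
  exact (ENNReal.lt_add_right ha (ENNReal.ofReal_pos.2 hw).ne').trans_le h

/-- Raising every edge weight by `γ` raises distances by at most `γ` times the number of
vertices. -/
theorem gdist_add_const_le [Fintype V] (hW : ∀ e ∈ E, 0 < W e) (γ : ℝ) (u v : V) :
    gdist E (fun e => W e + γ) u v ≤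
      gdist E W u v + Fintype.card V * ENNReal.ofReal γ := by
  classical
  let N : V → Finset V := fun x => Finset.univ.filter fun y => gdist E W u y < gdist E W u x
  suffices key : ∀ (c : ℕ) (x : V), (N x).card = c →
      gdist E (fun e => W e + γ) u x ≤ gdist E W u x + c * ENNReal.ofReal γ by
    refine (key _ v rfl).trans ?_
    gcongr
    exact Finset.card_le_univ _
  intro c
  induction c using Nat.strong_induction_on with
  | _ c ih =>
    intro x hx
    by_cases hux : u = x
    · simp [hux, gdist_self]
    by_cases htop : gdist E W u x = ⊤
    · simp [htop]
    obtain ⟨p, hp, hle⟩ := exists_pred hux htop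
    have hlt := lt_of_add_ofReal_le (hW _ hp) htop hle
    have hN : (N p).card < (N x).card := by
      refine Finset.card_lt_card (Finset.ssubset_iff_of_subset ?_ |>.2 ⟨p, ?_, ?_⟩)
      · intro y hy
        simp only [N, Finset.mem_filter, Finset.mem_univ, true_and] at hy ⊢
        exact hy.trans hlt
      · simpa [N] using hlt
      · simp [N]
    have h1 := ih _ (hx ▸ hN) p rfl
    have h2 : (((N p).card + 1 : ℕ) : ℝ≥0∞) ≤ c := by exact_mod_cast hx ▸ hN
    calc gdist E (fun e => W e + γ) u x
        ≤ gdist E (fun e => W e + γ) u p + gdist E (fun e => W e + γ) p x := gdist_triangle ..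
      _ ≤ (gdist E W u p + (N p).card * ENNReal.ofReal γ) +
            (ENNReal.ofReal (W (p, x)) + ENNReal.ofReal γ) := by
          refine add_le_add h1 ((gdist_edge hp).trans ?_)
          exact ENNReal.ofReal_add_le
      _ = (gdist E W u p + ENNReal.ofReal (W (p, x))) +
            ((N p).card + 1 : ℕ) * ENNReal.ofReal γ := by push_cast; ring
      _ ≤ _ := by gcongr

/-- Shortest-path trees out of and into the centre of a round-trip ball. -/
theorem exists_ball_trees [Fintype V] [DecidableEq V] (hW : ∀ e ∈ E, 0 < W e) (c : V)
    (B : Finset V) {R : ℝ≥0∞} (hR : R ≠ ⊤) (hB : ∀ x, x ∈ B ↔ rtdist E W c x ≤ R) :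
    ∃ T : Finset (V × V), (T : Set (V × V)) ⊆ E ∧ (∀ e ∈ T, e.1 ∈ B ∧ e.2 ∈ B) ∧
      T.card ≤ 2 * B.card ∧ ∀ x ∈ B, rtdist T W c x ≤ rtdist E W c x := by
  have hfin : ∀ x ∈ B, gdist E W c x ≠ ⊤ ∧ gdist E W x c ≠ ⊤ := fun x hx =>
    ENNReal.add_ne_top.1 (ne_top_of_le_ne_top hR ((hB x).1 hx))
  have hpred : ∀ x, ∃ p, x ∈ B → c ≠ x → (p, x) ∈ E ∧
      gdist E W c p + ENNReal.ofReal (W (p, x)) ≤ gdist E W c x := fun x => by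
    by_cases h : x ∈ B ∧ c ≠ x
    · obtain ⟨p, hp⟩ := exists_pred h.2 (hfin x h.1).1
      exact ⟨p, fun _ _ => hp⟩
    · exact ⟨x, fun h1 h2 => absurd ⟨h1, h2⟩ h⟩
  have hsucc : ∀ x, ∃ p, x ∈ B → c ≠ x → (x, p) ∈ E ∧
      ENNReal.ofReal (W (x, p)) + gdist E W p c ≤ gdist E W x c := fun x => by
    by_cases h : x ∈ B ∧ c ≠ x
    · obtain ⟨p, hp⟩ := exists_succ h.2.symm (hfin x h.1).2
      exact ⟨p, fun _ _ => hp⟩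
    · exact ⟨x, fun h1 h2 => absurd ⟨h1, h2⟩ h⟩
  choose p hp using hpred
  choose q hq using hsucc
  have hpB : ∀ x ∈ B, c ≠ x → p x ∈ B := fun x hx hcx => by
    obtain ⟨h1, h2⟩ := hp x hx hcx
    rw [hB]
    refine le_trans ?_ ((hB x).1 hx)
    calc gdist E W c (p x) + gdist E W (p x) c
        ≤ gdist E W c (p x) + (ENNReal.ofReal (W (p x, x)) + gdist E W x c) := by
          gcongr; exact gdist_le_edge_add h1 c
      _ ≤ _ := by rw [← add_assoc]; unfold rtdist; gcongr
  have hqB : ∀ x ∈ B, c ≠ x → q x ∈ B := fun x hx hcx => by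
    obtain ⟨h1, h2⟩ := hq x hx hcx
    rw [hB]
    refine le_trans ?_ ((hB x).1 hx)
    calc gdist E W c (q x) + gdist E W (q x) c
        ≤ (gdist E W c x + ENNReal.ofReal (W (x, q x))) + gdist E W (q x) c := by
          gcongr; exact (gdist_triangle E W c x (q x)).trans (by gcongr; exact gdist_edge h1)
      _ ≤ _ := by rw [add_assoc]; unfold rtdist; gcongr
  let T : Finset (V × V) :=
    (B.erase c).image (fun x => (p x, x)) ∪ (B.erase c).image (fun x => (x, q x))
  have hpT : ∀ x ∈ B, c ≠ x → (p x, x) ∈ T := fun x hx hcx =>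
    Finset.mem_union_left _
      (Finset.mem_image.2 ⟨x, Finset.mem_erase.2 ⟨hcx.symm, hx⟩, rfl⟩)
  have hqT : ∀ x ∈ B, c ≠ x → (x, q x) ∈ T := fun x hx hcx =>
    Finset.mem_union_right _
      (Finset.mem_image.2 ⟨x, Finset.mem_erase.2 ⟨hcx.symm, hx⟩, rfl⟩)
  have hTcases : ∀ e ∈ T, ∃ x ∈ B, c ≠ x ∧ (e = (p x, x) ∨ e = (x, q x)) := fun e he => by
    rcases Finset.mem_union.1 he with h | h <;>
    · obtain ⟨x, hx, rfl⟩ := Finset.mem_image.1 h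
      obtain ⟨h1, h2⟩ := Finset.mem_erase.1 hx
      exact ⟨x, h2, h1.symm, by simp⟩
  refine ⟨T, ?_, ?_, ?_, ?_⟩
  · intro e he
    obtain ⟨x, hx, hcx, rfl | rfl⟩ := hTcases e he
    · exact (hp x hx hcx).1
    · exact (hq x hx hcx).1
  · intro e he
    obtain ⟨x, hx, hcx, rfl | rfl⟩ := hTcases e he
    · exact ⟨hpB x hx hcx, hx⟩
    · exact ⟨hx, hqB x hx hcx⟩
  · have h0 : (B.erase c).card ≤ B.card := Finset.card_erase_le
    have h1 := Finset.card_union_le ((B.erase c).image fun x => (p x, x))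
      ((B.erase c).image fun x => (x, q x))
    have h2 : ((B.erase c).image fun x => (p x, x)).card ≤ _ := Finset.card_image_le
    have h3 : ((B.erase c).image fun x => (x, q x)).card ≤ _ := Finset.card_image_le
    change ((B.erase c).image (fun x => (p x, x)) ∪
      (B.erase c).image (fun x => (x, q x))).card ≤ _
    omega
  · have hout : ∀ x, x ∈ B → gdist T W c x ≤ gdist E W c x := fun x => by
      induction x using (Finite.wellFounded_of_trans_of_irrefl
        (InvImage (· < ·) fun x => gdist E W c x)).induction with
      | _ x ih =>
        intro hx
        by_cases hcx : c = x
        · simp [hcx, gdist_self]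
        obtain ⟨h1, h2⟩ := hp x hx hcx
        have hlt := lt_of_add_ofReal_le (hW _ h1) (hfin x hx).1 h2
        calc gdist T W c x ≤ gdist T W c (p x) + gdist T W (p x) x := gdist_triangle ..
          _ ≤ gdist E W c (p x) + ENNReal.ofReal (W (p x, x)) :=
              add_le_add (ih _ hlt (hpB x hx hcx)) (gdist_edge (hpT x hx hcx))
          _ ≤ _ := h2
    have hin : ∀ x, x ∈ B → gdist T W x c ≤ gdist E W x c := fun x => by
      induction x using (Finite.wellFounded_of_trans_of_irrefl
        (InvImage (· < ·) fun x => gdist E W x c)).induction with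
      | _ x ih =>
        intro hx
        by_cases hcx : c = x
        · simp [hcx, gdist_self]
        obtain ⟨h1, h2⟩ := hq x hx hcx
        have hlt := lt_of_add_ofReal_le (hW _ h1) (hfin x hx).2 (by rwa [add_comm])
        calc gdist T W x c ≤ gdist T W x (q x) + gdist T W (q x) c := gdist_triangle ..
          _ ≤ ENNReal.ofReal (W (x, q x)) + gdist E W (q x) c :=
              add_le_add (gdist_edge (hqT x hx hcx)) (ih _ hlt (hqB x hx hcx))
          _ ≤ _ := h2
    exact fun x hx => add_le_add (hout x hx) (hin x hx)

end Distances

section Scale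

variable {V : Type*} [Fintype V]

/-- A sequence that stays below `q ^ k * f 0` has a step at which it grows by a factor of at
most `q`. -/
theorem exists_succ_le_mul {q : ℝ} (hq : 0 ≤ q) {k : ℕ} (hk : 0 < k) {f : ℕ → ℝ}
    (h : f k ≤ q ^ k * f 0) : ∃ j < k, f (j + 1) ≤ q * f j := by
  by_contra! hcon
  have key : ∀ j, 0 < j → j ≤ k → q ^ j * f 0 < f j := by
    intro j
    induction j with
    | zero => intro h; omega
    | succ j ih =>
      intro _ hj
      rcases Nat.eq_zero_or_pos j with rfl | hj0
      · simpa using hcon 0 hk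
      · calc q ^ (j + 1) * f 0 = q * (q ^ j * f 0) := by ring
          _ ≤ q * f j := by gcongr; exact (ih hj0 (by omega)).le
          _ < f (j + 1) := hcon j (by omega)
  exact absurd h (not_le.2 (key k hk le_rfl))

/-- The edges of `E` with both endpoints in `A`. -/
def inducedEdges (E : Set (V × V)) (A : Finset V) : Set (V × V) :=
  {e | e ∈ E ∧ e.1 ∈ A ∧ e.2 ∈ A}

/-- If the round-trip ball around `u` lies in `A`, then restricting to `A` preserves the
round-trip distances in that ball. -/
theorem rtdist_induced_le {E : Set (V × V)} {W : V × V → ℝ} (hW : ∀ e ∈ E, 0 < W e) {A : Finset V}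
    {u v : V} {R : ℝ≥0∞} (hR : R ≠ ⊤) (hA : ∀ x, rtdist E W u x ≤ R → x ∈ A)
    (hv : rtdist E W u v ≤ R) : rtdist (inducedEdges E A) W u v ≤ rtdist E W u v := by
  classical
  obtain ⟨T, hTE, hTB, -, hT⟩ := exists_ball_trees hW u
    (Finset.univ.filter fun x => rtdist E W u x ≤ R) hR (by simp)
  have hsub : (T : Set (V × V)) ⊆ inducedEdges E A := fun e he =>
    ⟨hTE he, hA _ (by simpa using (hTB e he).1), hA _ (by simpa using (hTB e he).2)⟩
  exact (rtdist_anti hsub u v).trans (hT v (by simpa using hv))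

/-- Ball growing with respect to a vertex measure `m`. -/
theorem exists_scale_spanner_aux [DecidableEq V] (E : Finset (V × V)) (W : V × V → ℝ)
    (hW : ∀ e ∈ E, 0 < W e) (S : Finset V) (m : V → ℝ) (hm : ∀ x, 1 ≤ m x) {q : ℝ}
    (hq : 0 ≤ q) {k : ℕ} (hk : 0 < k) {M : ℝ} {R : ℝ≥0∞} (hR : R ≠ ⊤) (A : Finset V)
    (hS : ∀ u ∈ S, u ∈ A → M ≤ q ^ k * m u) (hM : ∑ x ∈ A, m x ≤ M) :
    ∃ F ⊆ E, (F.card : ℝ) ≤ 2 * q * ∑ x ∈ A, m x ∧ ∀ u ∈ S, u ∈ A → ∀ v ∈ A,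
      rtdist (inducedEdges E A) W u v ≤ R → rtdist F W u v ≤ 4 * k * R := by
  have hm0 : ∀ x, 0 ≤ m x := fun x => zero_le_one.trans (hm x)
  induction A using Finset.strongInduction with
  | H A ih =>
  by_cases hSA : ∃ c ∈ S, c ∈ A
  swap
  · refine ⟨∅, by simp, ?_, fun u hu huA => absurd ⟨u, hu, huA⟩ hSA⟩
    simpa using mul_nonneg (by positivity) (Finset.sum_nonneg fun x _ => hm0 x)
  obtain ⟨c, hcS, hcA⟩ := hSA
  set EA := inducedEdges (E : Set (V × V)) A with hEA
  have hWA : ∀ e ∈ EA, 0 < W e := fun e he => hW e he.1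
  let B : ℕ → Finset V := fun j => A.filter fun x => rtdist EA W c x ≤ 2 * j * R
  have hcB : ∀ j, c ∈ B j := fun j => by simp [B, hcA, rtdist_self]
  have hBA : ∀ j, B j ⊆ A := fun j => Finset.filter_subset _ _
  obtain ⟨j, hjk, hj⟩ := exists_succ_le_mul (f := fun j => ∑ x ∈ B j, m x) hq hk (by
    calc ∑ x ∈ B k, m x ≤ ∑ x ∈ A, m x :=
          Finset.sum_le_sum_of_subset_of_nonneg (hBA k) fun x _ _ => hm0 x
      _ ≤ M := hM
      _ ≤ q ^ k * m c := hS c hcS hcA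
      _ ≤ q ^ k * ∑ x ∈ B 0, m x := by
          gcongr
          exact Finset.single_le_sum (fun x _ => hm0 x) (hcB 0))
  have hrad : ∀ j : ℕ, 2 * (j : ℝ≥0∞) * R ≠ ⊤ := fun j => by
    exact ENNReal.mul_ne_top (ENNReal.mul_ne_top (by simp) (by simp)) hR
  have hmemA : ∀ x, rtdist EA W c x ≠ ⊤ → x ∈ A := fun x hx => by
    by_cases hcx : c = x
    · exact hcx ▸ hcA
    · obtain ⟨p, hp, -⟩ := exists_pred hcx (ENNReal.add_ne_top.1 hx).1
      exact hp.2.2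
  obtain ⟨T, hTE, -, hTc, hT⟩ := exists_ball_trees hWA c (B (j + 1)) (hrad (j + 1)) (fun x => by
    simp only [B, Finset.mem_filter, and_iff_right_iff_imp]
    exact fun hx => hmemA x (ne_top_of_le_ne_top (hrad _) hx))
  have hsub : A \ B j ⊂ A :=
    Finset.sdiff_ssubset (hBA j) ⟨c, hcB j⟩
  have hsum : ∑ x ∈ A \ B j, m x + ∑ x ∈ B j, m x = ∑ x ∈ A, m x :=
    Finset.sum_sdiff (hBA j)
  have hBnn : 0 ≤ ∑ x ∈ B j, m x := Finset.sum_nonneg fun x _ => hm0 x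
  obtain ⟨F, hFE, hFc, hF⟩ := ih (A \ B j) hsub
    (fun u hu huA => hS u hu (hsub.1 huA)) (by linarith)
  refine ⟨T ∪ F, ?_, ?_, ?_⟩
  · exact Finset.union_subset (fun e he => by simpa using (hTE he).1) hFE
  · have h1 : ((T ∪ F).card : ℝ) ≤ T.card + F.card := by
      exact_mod_cast Finset.card_union_le T F
    have h2 : (T.card : ℝ) ≤ 2 * (B (j + 1)).card := by exact_mod_cast hTc
    have h3 : ((B (j + 1)).card : ℝ) ≤ ∑ x ∈ B (j + 1), m x := by
      simpa using Finset.sum_le_sum (s := B (j + 1)) fun x _ => hm x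
    have h4 : 2 * q * ∑ x ∈ A, m x = 2 * q * ∑ x ∈ A \ B j, m x + 2 * (q * ∑ x ∈ B j, m x) := by
      rw [← hsum]; ring
    linarith
  · intro u hu huA v hvA huv
    have hRfin : ∀ x, rtdist EA W u x ≤ R → x ∈ A := fun x hx => by
      by_cases hux : u = x
      · exact hux ▸ huA
      · obtain ⟨p, hp, -⟩ := exists_pred hux
          (ENNReal.add_ne_top.1 (ne_top_of_le_ne_top hR hx)).1
        exact hp.2.2
    by_cases hz : ∃ z ∈ B j, rtdist EA W u z ≤ R
    · obtain ⟨z, hzB, hz⟩ := hz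
      have hcz : rtdist EA W c z ≤ 2 * j * R := (Finset.mem_filter.1 hzB).2
      have hcu : rtdist EA W c u ≤ 2 * j * R + R := by
        refine (rtdist_triangle EA W c z u).trans (add_le_add hcz ?_)
        rwa [rtdist_comm]
      have hcv : rtdist EA W c v ≤ 2 * j * R + R + R :=
        (rtdist_triangle EA W c u v).trans (add_le_add hcu huv)
      have hj1 : 2 * ((j + 1 : ℕ) : ℝ≥0∞) * R = 2 * j * R + R + R := by push_cast; ring
      have huB : u ∈ B (j + 1) :=
        Finset.mem_filter.2 ⟨huA, hj1 ▸ hcu.trans le_self_add⟩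
      have hvB : v ∈ B (j + 1) := Finset.mem_filter.2 ⟨hvA, hj1 ▸ hcv⟩
      have hle : (((j + 1 : ℕ) : ℝ≥0∞)) ≤ k := by exact_mod_cast hjk
      calc rtdist (↑(T ∪ F)) W u v ≤ rtdist T W u v := rtdist_anti (by simp) u v
        _ ≤ rtdist T W c u + rtdist T W c v := by
            rw [rtdist_comm (T : Set (V × V)) W c u]; exact rtdist_triangle _ _ _ _ _
        _ ≤ 2 * ((j + 1 : ℕ) : ℝ≥0∞) * R + 2 * ((j + 1 : ℕ) : ℝ≥0∞) * R :=
            add_le_add ((hT u huB).trans (Finset.mem_filter.1 huB).2)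
              ((hT v hvB).trans (Finset.mem_filter.1 hvB).2)
        _ = 4 * ((j + 1 : ℕ) : ℝ≥0∞) * R := by ring
        _ ≤ _ := by gcongr
    · push Not at hz
      have hout : ∀ x, rtdist EA W u x ≤ R → x ∈ A \ B j := fun x hx =>
        Finset.mem_sdiff.2 ⟨hRfin x hx, fun hxB => absurd hx (not_le.2 (hz x hxB))⟩
      have h1 := rtdist_induced_le hWA hR hout huv
      have h2 : inducedEdges EA (A \ B j) ⊆ inducedEdges (E : Set (V × V)) (A \ B j) :=
        fun e he => ⟨he.1.1, he.2⟩
      refine (rtdist_anti (by simp) u v).trans (hF u hu (hout u (by simp [rtdist_self])) v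
        (hout v huv) ?_)
      exact ((rtdist_anti h2 u v).trans h1).trans huv

theorem exists_scale_spanner [DecidableEq V] (E : Finset (V × V)) (W : V × V → ℝ)
    (hW : ∀ e ∈ E, 0 < W e) (S : Finset V) {q : ℝ} (hq : 0 ≤ q) {k : ℕ} (hk : 0 < k)
    (hqS : 2 * (S.card : ℝ) ≤ q ^ k) {R : ℝ≥0∞} (hR : R ≠ ⊤) (A : Finset V) :
    ∃ F ⊆ E, (F.card : ℝ) ≤ 4 * q * A.card ∧ ∀ u ∈ S, u ∈ A → ∀ v ∈ A,
      rtdist (inducedEdges E A) W u v ≤ R → rtdist F W u v ≤ 4 * k * R := by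
  let S' := A.filter (· ∈ S)
  let m : V → ℝ := fun x => 1 + if x ∈ S then (A.card : ℝ) / S'.card else 0
  have hsum : ∑ x ∈ A, m x ≤ 2 * A.card := by
    simp only [m, Finset.sum_add_distrib, ← Finset.sum_filter]
    rw [Finset.sum_const, Finset.sum_const]
    have : (S'.card : ℝ) * (A.card / S'.card) ≤ A.card := by
      rcases Nat.eq_zero_or_pos S'.card with h | h
      · simp [h]
      · field_simp; exact le_rfl
    simp only [nsmul_eq_mul, mul_one]
    change _ + (S'.card : ℝ) * (A.card / S'.card) ≤ _
    linarith
  obtain ⟨F, hFE, hFc, hF⟩ := exists_scale_spanner_aux E W hW S m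
    (fun x => by simp only [m]; split_ifs <;> simp; positivity) hq hk hR A (M := 2 * A.card) (by
      intro u hu huA
      have hS'pos : 0 < S'.card := Finset.card_pos.2 ⟨u, Finset.mem_filter.2 ⟨huA, hu⟩⟩
      have hS'S : (S'.card : ℝ) ≤ S.card := by
        exact_mod_cast Finset.card_le_card fun x hx => (Finset.mem_filter.1 hx).2
      have hS'pos' : (0 : ℝ) < S'.card := by exact_mod_cast hS'pos
      calc 2 * (A.card : ℝ) = 2 * S'.card * (A.card / S'.card) := by field_simp
        _ ≤ q ^ k * (A.card / S'.card) := by gcongr; linarith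
        _ ≤ q ^ k * m u := by
          gcongr
          simp [m, hu]) hsum
  refine ⟨F, hFE, hFc.trans ?_, hF⟩
  calc 2 * q * ∑ x ∈ A, m x ≤ 2 * q * (2 * A.card) := by gcongr
    _ = _ := by ring

end Scale

section Quotient

variable {V Q : Type*}

/-- The edges induced on a quotient, each with a cheapest lift, and all weights raised by `γ`. -/
theorem exists_quotient_edges [DecidableEq Q] (E : Finset (V × V)) (W : V × V → ℝ) {π : V → Q}
    (hπ : Function.Surjective π) (γ : ℝ) :
    ∃ (EQ : Finset (Q × Q)) (w : Q × Q → ℝ) (lift : Q × Q → V × V),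
      (∀ e ∈ EQ, lift e ∈ E ∧ (π (lift e).1, π (lift e).2) = e ∧ w e = W (lift e) + γ) ∧
      ∀ a b, (a, b) ∈ E → (π a, π b) ∈ EQ ∧ w (π a, π b) ≤ W (a, b) + γ := by
  classical
  let EQ := E.image (Prod.map π π)
  have hex : ∀ e : Q × Q, ∃ f : V × V, e ∈ EQ → f ∈ E ∧ Prod.map π π f = e ∧
      ∀ g ∈ E, Prod.map π π g = e → W f ≤ W g := fun e => by
    by_cases he : e ∈ EQ
    · obtain ⟨f, hf, hfe⟩ := Finset.mem_image.1 he
      obtain ⟨g, hg, hmin⟩ := Finset.exists_min_image (E.filter (Prod.map π π · = e)) W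
        ⟨f, Finset.mem_filter.2 ⟨hf, hfe⟩⟩
      obtain ⟨hgE, hge⟩ := Finset.mem_filter.1 hg
      exact ⟨g, fun _ => ⟨hgE, hge, fun g' h1 h2 => hmin g' (Finset.mem_filter.2 ⟨h1, h2⟩)⟩⟩
    · obtain ⟨a, -⟩ := hπ e.1
      exact ⟨(a, a), fun h => absurd h he⟩
  choose lift hlift using hex
  refine ⟨EQ, fun e => W (lift e) + γ, lift, fun e he =>
    ⟨(hlift e he).1, (hlift e he).2.1, rfl⟩, fun a b hab => ?_⟩
  have hmem : (π a, π b) ∈ EQ := Finset.mem_image.2 ⟨(a, b), hab, rfl⟩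
  exact ⟨hmem, by have := (hlift _ hmem).2.2 (a, b) hab rfl; simpa using this⟩

theorem gdist_map_le {E : Set (V × V)} {EQ : Set (Q × Q)} {W : V × V → ℝ} {w : Q × Q → ℝ}
    {π : V → Q} (h : ∀ a b, (a, b) ∈ E → (π a, π b) ∈ EQ ∧ w (π a, π b) ≤ W (a, b)) (x y : V) :
    gdist EQ w (π x) (π y) ≤ gdist E W x y := by
  have := le_gdist_add_of_edge (E := E) (W := W) (φ := fun a => gdist EQ w (π a) (π y))
    (fun a b hab => (gdist_le_edge_add (h a b hab).1 _).trans (by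
      gcongr; exact (h a b hab).2)) x y
  simpa [gdist_self] using this

/-- Paths in the quotient lift to paths in `H`, provided that moving inside a class is cheap. -/
theorem gdist_le_gdist_quotient_add {H : Set (V × V)} {F : Set (Q × Q)} {W : V × V → ℝ}
    {w : Q × Q → ℝ} {π : V → Q} {γ : ℝ≥0∞}
    (hF : ∀ e ∈ F, ∃ p q, (p, q) ∈ H ∧ (π p, π q) = e ∧
      ENNReal.ofReal (W (p, q)) + γ ≤ ENNReal.ofReal (w e))
    (hγ : ∀ x y, π x = π y → gdist H W x y ≤ γ) (x y : V) :
    gdist H W x y ≤ gdist F w (π x) (π y) + γ := by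
  have := le_gdist_add_of_edge (E := F) (W := w)
    (φ := fun a => ⨆ (z : V) (_ : π z = a), gdist H W z y) ?_ (π x) (π y)
  · refine le_trans ?_ (this.trans ?_)
    · exact le_iSup₂ (f := fun (z : V) (_ : π z = π x) => gdist H W z y) x rfl
    · gcongr
      exact iSup₂_le fun z hz => hγ z y hz
  · intro a b hab
    obtain ⟨p, q, hpq, he, hle⟩ := hF _ hab
    obtain ⟨rfl, rfl⟩ := Prod.mk.inj he
    refine iSup₂_le fun z hz => ?_
    calc gdist H W z y ≤ gdist H W z p + gdist H W p y := gdist_triangle ..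
      _ ≤ γ + (ENNReal.ofReal (W (p, q)) + gdist H W q y) :=
          add_le_add (hγ z p hz) (gdist_le_edge_add hpq y)
      _ = ENNReal.ofReal (W (p, q)) + γ + gdist H W q y := by ring
      _ ≤ _ := by
          refine add_le_add hle ?_
          exact le_iSup₂ (f := fun (z : V) (_ : π z = π q) => gdist H W z y) q rfl

/-- A sparse set of edges that takes care, up to movements inside the classes of `π`, of all
round-trip distances up to `R`. Its size is bounded in terms of the number of classes that
have another class within distance about `R`. -/
theorem exists_level_spanner [Fintype V] [Fintype Q] (E : Finset (V × V)) (W : V × V → ℝ)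
    (hW : ∀ e ∈ E, 0 < W e) (S : Finset V) {q : ℝ} (hq : 0 ≤ q) {k : ℕ} (hk : 0 < k)
    (hqS : 2 * (S.card : ℝ) ≤ q ^ k) {π : V → Q} (hπ : Function.Surjective π) {γ R : ℝ}
    (hγ : 0 < γ) (hR : 0 < R) :
    ∃ F ⊆ E, ∃ A : Finset Q, (F.card : ℝ) ≤ 4 * q * A.card ∧
      ((∀ x y, π x = π y → gdist E W x y ≤ ENNReal.ofReal γ) → ∀ a ∈ A, ∃ u ∈ S, ∃ v,
        π u ≠ π v ∧ (π u = a ∨ π v = a) ∧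
          rtdist E W u v ≤ ENNReal.ofReal (R + 2 * Fintype.card V * γ + 2 * γ)) ∧
      ∀ H : Set (V × V), (F : Set (V × V)) ⊆ H →
        (∀ x y, π x = π y → gdist H W x y ≤ ENNReal.ofReal γ) →
        ∀ u ∈ S, ∀ v, π u ≠ π v → rtdist E W u v ≤ ENNReal.ofReal R →
          rtdist H W u v ≤ ENNReal.ofReal (4 * k * (R + 2 * Fintype.card V * γ) + 2 * γ) := by
  classical
  obtain ⟨EQ, w, lift, hlift, hEQ⟩ := exists_quotient_edges E W hπ γ
  set n := Fintype.card V
  set R' : ℝ := R + 2 * n * γ with hR'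
  have hR'0 : 0 ≤ R' := by positivity
  have hw : ∀ e ∈ EQ, 0 < w e := fun e he => by
    obtain ⟨h1, -, h3⟩ := hlift e he
    have := hW _ h1
    linarith
  have hlift' : ∀ e ∈ EQ, ∀ H : Set (V × V), lift e ∈ H → ∃ p q, (p, q) ∈ H ∧ (π p, π q) = e ∧
      ENNReal.ofReal (W (p, q)) + ENNReal.ofReal γ ≤ ENNReal.ofReal (w e) := fun e he H hH => by
    obtain ⟨h1, h2, h3⟩ := hlift e he
    exact ⟨(lift e).1, (lift e).2, hH, h2, by
      rw [h3, ENNReal.ofReal_add (hW _ h1).le hγ.le]⟩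
  have hdown : ∀ x y, gdist EQ w (π x) (π y) ≤ gdist E W x y + ENNReal.ofReal (n * γ) :=
    fun x y => by
      refine (gdist_map_le (W := fun e => W e + γ) hEQ x y).trans ?_
      refine (gdist_add_const_le (by simpa using hW) γ x y).trans_eq ?_
      rw [ENNReal.ofReal_mul (by positivity), ENNReal.ofReal_natCast]
  let A : Finset Q := Finset.univ.filter fun x => ∃ y, x ≠ y ∧
    rtdist EQ w x y ≤ ENNReal.ofReal R' ∧ (x ∈ S.image π ∨ y ∈ S.image π)
  obtain ⟨F, hFE, hFc, hF⟩ := exists_scale_spanner EQ w hw (S.image π) hq hk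
    (le_trans (by gcongr; exact Finset.card_image_le) hqS) (R := ENNReal.ofReal R')
    ENNReal.ofReal_ne_top A
  refine ⟨F.image lift, ?_, A, ?_, ?_, ?_⟩
  · intro e he
    obtain ⟨f, hf, rfl⟩ := Finset.mem_image.1 he
    exact (hlift f (hFE hf)).1
  · refine le_trans ?_ hFc
    exact_mod_cast Finset.card_image_le
  · intro hdiam a ha
    obtain ⟨b, hab, hle, hS⟩ := (Finset.mem_filter.1 ha).2
    have hup : ∀ x y, gdist E W x y ≤ gdist EQ w (π x) (π y) + ENNReal.ofReal γ :=
      gdist_le_gdist_quotient_add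
        (fun e he => hlift' e he _ (hlift e he).1) hdiam
    have hrt : ∀ x y, rtdist EQ w (π x) (π y) ≤ ENNReal.ofReal R' →
        rtdist E W x y ≤ ENNReal.ofReal (R' + 2 * γ) := fun x y hxy => by
      calc rtdist E W x y ≤ (gdist EQ w (π x) (π y) + ENNReal.ofReal γ) +
            (gdist EQ w (π y) (π x) + ENNReal.ofReal γ) := add_le_add (hup x y) (hup y x)
        _ = rtdist EQ w (π x) (π y) + (ENNReal.ofReal γ + ENNReal.ofReal γ) := by
            unfold rtdist; ring
        _ ≤ ENNReal.ofReal R' + (ENNReal.ofReal γ + ENNReal.ofReal γ) := by gcongr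
        _ = _ := by
            rw [← ENNReal.ofReal_add hγ.le hγ.le, ← ENNReal.ofReal_add hR'0 (by positivity)]
            ring_nf
    rcases hS with hS | hS <;> obtain ⟨u, hu, rfl⟩ := Finset.mem_image.1 hS
    · obtain ⟨v, rfl⟩ := hπ b
      exact ⟨u, hu, v, hab, Or.inl rfl, hrt u v hle⟩
    · obtain ⟨v, rfl⟩ := hπ a
      exact ⟨u, hu, v, hab.symm, Or.inr rfl, hrt u v (by rwa [rtdist_comm])⟩
  · intro H hH hdiam u hu v huv hle
    have hQ : rtdist EQ w (π u) (π v) ≤ ENNReal.ofReal R' := by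
      calc rtdist EQ w (π u) (π v) ≤ (gdist E W u v + ENNReal.ofReal (n * γ)) +
            (gdist E W v u + ENNReal.ofReal (n * γ)) := add_le_add (hdown u v) (hdown v u)
        _ = rtdist E W u v + (ENNReal.ofReal (n * γ) + ENNReal.ofReal (n * γ)) := by
            unfold rtdist; ring
        _ ≤ ENNReal.ofReal R + (ENNReal.ofReal (n * γ) + ENNReal.ofReal (n * γ)) := by gcongr
        _ = _ := by
            rw [← ENNReal.ofReal_add (by positivity) (by positivity),
              ← ENNReal.ofReal_add hR.le (by positivity), hR']
            ring_nf
    have huS : π u ∈ S.image π := Finset.mem_image_of_mem π hu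
    have hA : ∀ x, rtdist EQ w (π u) x ≤ ENNReal.ofReal R' → x ∈ A := fun x hx => by
      refine Finset.mem_filter.2 ⟨Finset.mem_univ _, ?_⟩
      by_cases hxu : x = π u
      · subst hxu
        exact ⟨π v, huv, hQ, Or.inl huS⟩
      · exact ⟨π u, hxu, by rwa [rtdist_comm], Or.inr huS⟩
    have h1 : rtdist F w (π u) (π v) ≤ 4 * k * ENNReal.ofReal R' :=
      hF _ huS (hA _ (by simp [rtdist_self])) _ (hA _ hQ)
        ((rtdist_induced_le (by simpa using hw) ENNReal.ofReal_ne_top hA hQ).trans hQ)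
    have hup : ∀ x y, gdist H W x y ≤ gdist F w (π x) (π y) + ENNReal.ofReal γ :=
      gdist_le_gdist_quotient_add
        (fun e he => hlift' e (hFE he) _ (hH (by
          simpa using Finset.mem_image_of_mem lift (Finset.mem_coe.1 he)))) hdiam
    calc rtdist H W u v ≤ (gdist F w (π u) (π v) + ENNReal.ofReal γ) +
          (gdist F w (π v) (π u) + ENNReal.ofReal γ) := add_le_add (hup u v) (hup v u)
      _ = rtdist F w (π u) (π v) + (ENNReal.ofReal γ + ENNReal.ofReal γ) := by
          unfold rtdist; ring
      _ ≤ 4 * k * ENNReal.ofReal R' + (ENNReal.ofReal γ + ENNReal.ofReal γ) := by gcongr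
      _ = _ := by
          rw [ENNReal.ofReal_add (p := 4 * k * R') (by positivity) (by positivity),
            ENNReal.ofReal_mul (q := R') (by positivity), ENNReal.ofReal_mul (by positivity),
            ENNReal.ofReal_natCast, ENNReal.ofReal_ofNat, two_mul γ,
            ENNReal.ofReal_add hγ.le hγ.le]

end Quotient

section Counting

theorem le_card_mul_of_reachable {V : Type*} [Fintype V] {f : V → V → ℝ≥0∞}
    (hf0 : ∀ x, f x x = 0) (hf : ∀ x y z, f x z ≤ f x y + f y z) {G : SimpleGraph V} {β : ℝ≥0∞}
    (hβ : ∀ x y, G.Adj x y → f x y ≤ β) {x y : V} (h : G.Reachable x y) :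
    f x y ≤ Fintype.card V * β := by
  classical
  have key : ∀ {x y : V} (p : G.Walk x y), f x y ≤ p.length * β := fun p => by
    induction p with
    | nil => simp [hf0]
    | cons hadj p ih =>
      refine (hf _ _ _).trans ((add_le_add (hβ _ _ hadj) ih).trans_eq ?_)
      simp only [SimpleGraph.Walk.length_cons]
      push_cast
      ring
  obtain ⟨p, hp⟩ := h.exists_isPath
  refine (key p).trans ?_
  gcongr
  exact hp.length_lt.le

theorem card_add_two_mul_card_le {X Y : Type*} [Fintype X] [Fintype Y] {f : X → Y}
    (hf : Function.Surjective f) (A : Finset X) (hA : ∀ a ∈ A, ∃ b, b ≠ a ∧ f b = f a) :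
    A.card + 2 * Fintype.card Y ≤ 2 * Fintype.card X := by
  classical
  have h1 : A.card = ∑ y : Y, (A.filter (f · = y)).card :=
    Finset.card_eq_sum_card_fiberwise fun _ _ => Finset.mem_coe.2 (Finset.mem_univ _)
  have h2 : Fintype.card X = ∑ y : Y, (Finset.univ.filter (f · = y)).card :=
    Finset.card_eq_sum_card_fiberwise fun _ _ => Finset.mem_coe.2 (Finset.mem_univ _)
  have h3 : 2 * Fintype.card Y = ∑ _y : Y, 2 := by simp [mul_comm]
  rw [h1, h2, h3, ← Finset.sum_add_distrib, Finset.mul_sum]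
  refine Finset.sum_le_sum fun y _ => ?_
  have hle : (A.filter (f · = y)).card ≤ (Finset.univ.filter (f · = y)).card :=
    Finset.card_le_card (Finset.filter_subset_filter _ (Finset.subset_univ _))
  rcases Finset.eq_empty_or_nonempty (A.filter (f · = y)) with h | ⟨a, ha⟩
  · obtain ⟨x, hx⟩ := hf y
    have : 0 < (Finset.univ.filter (f · = y)).card :=
      Finset.card_pos.2 ⟨x, by simpa using hx⟩
    rw [h, Finset.card_empty]
    omega
  · obtain ⟨haA, hay⟩ := Finset.mem_filter.1 ha
    obtain ⟨b, hba, hb⟩ := hA a haA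
    have : 1 < (Finset.univ.filter (f · = y)).card :=
      Finset.one_lt_card.2 ⟨b, by simp [hb, hay], a, by simp [hay], hba⟩
    omega

theorem sum_range_le_of_add_two_mul_le {a c : ℕ → ℕ} {n L : ℕ} (hc : ∀ i, c i ≤ n)
    (h : ∀ i, a i + 2 * c (i + L) ≤ 2 * c i) (T : ℕ) : ∑ i ∈ Finset.range T, a i ≤ 2 * L * n := by
  have key : ∑ i ∈ Finset.range T, a i + 2 * ∑ i ∈ Finset.range L, c (T + i) ≤
      2 * ∑ i ∈ Finset.range L, c i := by
    induction T with
    | zero => simp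
    | succ T ih =>
      have h1 := Finset.sum_range_succ (fun i => c (T + i)) L
      rw [Finset.sum_range_succ'] at h1
      have h2 : ∑ i ∈ Finset.range L, c (T + 1 + i) = ∑ i ∈ Finset.range L, c (T + (i + 1)) :=
        Finset.sum_congr rfl fun i _ => by congr 1; omega
      rw [Finset.sum_range_succ, h2]
      have := h T
      simp only [add_zero] at h1
      omega
  have hle : ∑ i ∈ Finset.range L, c i ≤ L * n := by
    simpa using Finset.sum_le_sum (s := Finset.range L) fun i _ => hc i
  calc _ ≤ 2 * (L * n) := by omega
    _ = _ := by ring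

end Counting

section Assembly

variable {V : Type*}

/-- Two vertices are adjacent if one of them is a source and their round-trip distance is at
most `δ`. -/
def closeGraph (E : Set (V × V)) (W : V × V → ℝ) (S : Finset V) (δ : ℝ) : SimpleGraph V :=
  SimpleGraph.fromRel fun u v => u ∈ S ∧ rtdist E W u v ≤ ENNReal.ofReal δ

theorem closeGraph_mono (E : Set (V × V)) (W : V × V → ℝ) (S : Finset V) {δ δ' : ℝ}
    (h : δ ≤ δ') : closeGraph E W S δ ≤ closeGraph E W S δ' := by
  intro x y hxy
  rw [closeGraph, SimpleGraph.fromRel_adj] at hxy ⊢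
  refine ⟨hxy.1, hxy.2.imp ?_ ?_⟩ <;>
  exact fun h' => ⟨h'.1, h'.2.trans (ENNReal.ofReal_le_ofReal h)⟩

/-- Raising the threshold from `δ` to `δ'` merges each class in `A` with another class. -/
theorem card_closeGraph_le {E : Set (V × V)} {W : V × V → ℝ} {S : Finset V} {δ δ' : ℝ}
    (h : δ ≤ δ') [Fintype (closeGraph E W S δ).ConnectedComponent]
    [Fintype (closeGraph E W S δ').ConnectedComponent]
    (A : Finset (closeGraph E W S δ).ConnectedComponent)
    (hA : ∀ a ∈ A, ∃ u ∈ S, ∃ v, (closeGraph E W S δ).connectedComponentMk u ≠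
        (closeGraph E W S δ).connectedComponentMk v ∧
      ((closeGraph E W S δ).connectedComponentMk u = a ∨
        (closeGraph E W S δ).connectedComponentMk v = a) ∧
      rtdist E W u v ≤ ENNReal.ofReal δ') :
    A.card + 2 * Fintype.card (closeGraph E W S δ').ConnectedComponent ≤
      2 * Fintype.card (closeGraph E W S δ).ConnectedComponent := by
  let f : (closeGraph E W S δ).ConnectedComponent → (closeGraph E W S δ').ConnectedComponent :=
    SimpleGraph.ConnectedComponent.map (SimpleGraph.Hom.ofLE (closeGraph_mono E W S h))
  have hf : ∀ x, f ((closeGraph E W S δ).connectedComponentMk x) =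
      (closeGraph E W S δ').connectedComponentMk x := fun _ => rfl
  refine card_add_two_mul_card_le (f := f) (fun y => ?_) A fun a ha => ?_
  · obtain ⟨x, rfl⟩ := y.exists_rep
    exact ⟨_, hf x⟩
  · obtain ⟨u, hu, v, huv, ha', hle⟩ := hA a ha
    have hadj : (closeGraph E W S δ').Adj u v := by
      rw [closeGraph, SimpleGraph.fromRel_adj]
      exact ⟨fun h => huv (congrArg _ h), Or.inl ⟨hu, hle⟩⟩
    have heq : f ((closeGraph E W S δ).connectedComponentMk u) =
        f ((closeGraph E W S δ).connectedComponentMk v) := by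
      rw [hf, hf]
      exact SimpleGraph.ConnectedComponent.connectedComponentMk_eq_of_adj hadj
    rcases ha' with rfl | rfl
    · exact ⟨_, huv.symm, heq.symm⟩
    · exact ⟨_, huv, heq⟩

variable [Fintype V]

/-- If sources are `H`-close to all vertices at distance at most `δ`, then vertices in the same
component of `closeGraph` are `H`-close. -/
theorem rtdist_le_of_mk_eq {E H : Set (V × V)} {W : V × V → ℝ} {S : Finset V} {δ β : ℝ}
    (h : ∀ u ∈ S, ∀ v, rtdist E W u v ≤ ENNReal.ofReal δ → rtdist H W u v ≤ ENNReal.ofReal β)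
    {x y : V} (hxy : (closeGraph E W S δ).connectedComponentMk x =
      (closeGraph E W S δ).connectedComponentMk y) :
    rtdist H W x y ≤ ENNReal.ofReal (Fintype.card V * β) := by
  rw [ENNReal.ofReal_mul (by positivity), ENNReal.ofReal_natCast]
  refine le_card_mul_of_reachable (rtdist_self H W) (rtdist_triangle H W) ?_
    (SimpleGraph.ConnectedComponent.exact hxy)
  intro a b hab
  rw [closeGraph, SimpleGraph.fromRel_adj] at hab
  rcases hab.2 with h' | h'
  · exact h a h'.1 b h'.2
  · rw [rtdist_comm]; exact h b h'.1 a h'.2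

theorem exists_dist_range (E : Set (V × V)) {W : V × V → ℝ} (hW : ∀ e ∈ E, 0 < W e) :
    ∃ ε : ℝ, 0 < ε ∧ (∀ u v, u ≠ v → ENNReal.ofReal ε < rtdist E W u v) ∧
      ∃ T : ℕ, ∀ u v, rtdist E W u v ≠ ⊤ → rtdist E W u v ≤ ENNReal.ofReal (ε * 2 ^ T) := by
  have h1 : ∀ᶠ ε : ℝ in nhdsWithin 0 (Set.Ioi 0),
      ∀ p : V × V, p.1 ≠ p.2 → ENNReal.ofReal ε < rtdist E W p.1 p.2 := by
    rw [Filter.eventually_all]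
    intro p
    by_cases hp : p.1 = p.2
    · simp [hp]
    · have hpos : ENNReal.ofReal 0 < rtdist E W p.1 p.2 := by
        rw [ENNReal.ofReal_zero]
        exact (gdist_pos hW hp).trans_le le_self_add
      have := (ENNReal.continuous_ofReal.tendsto 0).eventually (gt_mem_nhds hpos)
      exact (this.filter_mono nhdsWithin_le_nhds).mono fun _ h _ => h
  obtain ⟨ε, hε, hε0⟩ := (h1.and self_mem_nhdsWithin).exists
  refine ⟨ε, hε0, fun u v huv => hε (u, v) huv, ?_⟩
  have h2 : ∀ᶠ T : ℕ in Filter.atTop, ∀ p : V × V, rtdist E W p.1 p.2 ≠ ⊤ →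
      rtdist E W p.1 p.2 ≤ ENNReal.ofReal (ε * 2 ^ T) := by
    rw [Filter.eventually_all]
    intro p
    have ht : Filter.Tendsto (fun T : ℕ => ε * (2 : ℝ) ^ T) Filter.atTop Filter.atTop :=
      (tendsto_pow_atTop_atTop_of_one_lt one_lt_two).const_mul_atTop hε0
    filter_upwards [ht.eventually_ge_atTop (rtdist E W p.1 p.2).toReal] with T hT htop
    rw [← ENNReal.ofReal_toReal htop]
    exact ENNReal.ofReal_le_ofReal hT
  obtain ⟨T, hT⟩ := h2.exists
  exact ⟨T, fun u v => hT (u, v)⟩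

/-- Radii `R i` growing by factors of two, with the bounds `γ i` on the diameters of classes and
the thresholds `δ i` defining these classes. -/
theorem exists_level_parameters {ε n : ℝ} (hε : 0 < ε) (hn2 : 2 ≤ n) {k L : ℕ} (hk : 0 < k)
    (hL : 108 * n ^ 2 * k ≤ 2 ^ L) :
    ∃ R γ δ : ℕ → ℝ, (∀ i, R i = ε * 2 ^ i) ∧ (∀ i, R (i + 1) = 2 * R i) ∧ (∀ i, 0 < R i) ∧
      (∀ i, 0 < γ i) ∧ (∀ i, 0 < δ i) ∧ (∀ i, 2 * n * γ i = R i) ∧ (∀ i, 4 * γ i ≤ R i) ∧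
      (∀ i, n * (18 * k * δ i) = γ i) ∧ (∀ i, n * δ i ≤ γ i) ∧ (∀ i, δ (i + 1) ≤ R i) ∧
      (∀ i, R i + 2 * n * γ i + 2 * γ i ≤ δ (i + L)) ∧ ∀ i, δ i ≤ δ (i + L) := by
  have hn0 : (0 : ℝ) < n := by linarith
  have hk1 : (1 : ℝ) ≤ k := by exact_mod_cast hk
  have hk0 : (0 : ℝ) < k := by linarith
  let R : ℕ → ℝ := fun i => ε * 2 ^ i
  let γ : ℕ → ℝ := fun i => R i / (2 * n)
  let δ : ℕ → ℝ := fun i => R i / (36 * n ^ 2 * k)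
  have hR : ∀ i, 0 < R i := fun i => by positivity
  have hγ : ∀ i, 0 < γ i := fun i => by have := hR i; positivity
  have hδ : ∀ i, 0 < δ i := fun i => by have := hR i; positivity
  have hγR : ∀ i, 2 * n * γ i = R i := fun i => by simp only [γ]; field_simp
  have hγR' : ∀ i, 4 * γ i ≤ R i := fun i => by
    rw [← hγR i]; have := hγ i; nlinarith
  have hδγ : ∀ i, n * (18 * k * δ i) = γ i := fun i => by
    simp only [γ, δ]; field_simp; ring
  have hδγ' : ∀ i, n * δ i ≤ γ i := fun i => by
    rw [← hδγ i]
    have := hδ i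
    gcongr
    nlinarith
  have hδR : ∀ i, δ (i + 1) ≤ R i := fun i => by
    have h1 : n * δ (i + 1) ≤ R (i + 1) / 4 := by linarith [hδγ' (i + 1), hγR' (i + 1)]
    have h2 : R (i + 1) = 2 * R i := by simp only [R]; ring
    have := hδ (i + 1)
    have := hR i
    nlinarith
  have hδL : ∀ i, R i + 2 * n * γ i + 2 * γ i ≤ δ (i + L) := fun i => by
    have h1 : δ (i + L) = R i * 2 ^ L / (36 * n ^ 2 * k) := by
      simp only [δ, R]; rw [pow_add]; ring
    have h2 : 3 * R i ≤ δ (i + L) := by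
      rw [h1, le_div_iff₀ (by positivity)]
      have := mul_le_mul_of_nonneg_left hL (hR i).le
      linarith
    linarith [hγR i, hγR' i, hγ i]
  refine ⟨R, γ, δ, fun _ => rfl, fun i => by simp only [R]; ring, hR, hγ, hδ, hγR, hγR', hδγ,
    hδγ', hδR, hδL, fun i => ?_⟩
  have h1 := hδL i
  have h2 := hδγ' i
  have h3 := hδ i
  have h4 := hR i
  have h5 := hγ i
  nlinarith

theorem exists_sourcewise_spanner (E : Finset (V × V)) (W : V × V → ℝ)
    (hW : ∀ e ∈ E, 0 < W e) (hV : 2 ≤ Fintype.card V) (S : Finset V) {q : ℝ} (hq : 0 ≤ q)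
    {k : ℕ} (hk : 0 < k) (hqS : 2 * (S.card : ℝ) ≤ q ^ k) {L : ℕ}
    (hL : 108 * (Fintype.card V : ℝ) ^ 2 * k ≤ 2 ^ L) :
    ∃ F ⊆ E, (F.card : ℝ) ≤ 8 * q * L * Fintype.card V ∧
      ∀ u ∈ S, ∀ v, rtdist F W u v ≤ ENNReal.ofReal (18 * k) * rtdist E W u v := by
  classical
  obtain ⟨ε, hε, hsep, T, hT⟩ := exists_dist_range (E : Set (V × V)) hW
  set n := Fintype.card V with hn
  have hn2 : (2 : ℝ) ≤ n := by exact_mod_cast hV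
  obtain ⟨R, γ, δ, hR0, hRs, hR, hγ, hδ, hγR, hγR', hδγ, hδγ', hδR, hδL, hδi⟩ :=
    exists_level_parameters hε hn2 hk hL
  have hk1 : (1 : ℝ) ≤ k := by exact_mod_cast hk
  let G : ℕ → SimpleGraph V := fun i => closeGraph E W S (δ i)
  let Q : ℕ → Type _ := fun i => (G i).ConnectedComponent
  have : ∀ i, Fintype (Q i) := fun i => Fintype.ofFinite _
  let π : ∀ i, V → Q i := fun i => (G i).connectedComponentMk
  have hπ : ∀ i, Function.Surjective (π i) := fun i => Quot.mk_surjective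
  have hlevel := fun i =>
    exists_level_spanner E W hW S hq hk hqS (hπ i) (hγ i) (hR i)
  choose F hFE A hFc hA hF using hlevel
  have hdiamE : ∀ i x y, π i x = π i y → gdist E W x y ≤ ENNReal.ofReal (γ i) :=
    fun i x y hxy => by
      refine le_self_add.trans ((rtdist_le_of_mk_eq (fun u _ v h => h) hxy).trans ?_)
      exact ENNReal.ofReal_le_ofReal (hδγ' i)
  have hcount : ∀ i, (A i).card + 2 * Fintype.card (Q (i + L)) ≤ 2 * Fintype.card (Q i) :=
    fun i => by
      refine card_closeGraph_le (hδi i) (A i) fun a ha => ?_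
      obtain ⟨u, hu, v, huv, ha', hle⟩ := hA i (hdiamE i) a ha
      exact ⟨u, hu, v, huv, ha', hle.trans (ENNReal.ofReal_le_ofReal (hδL i))⟩
  have hcard : ∀ i, Fintype.card (Q i) ≤ n := fun i => Fintype.card_le_of_surjective _ (hπ i)
  let H := (Finset.range (T + 1)).biUnion F
  refine ⟨H, Finset.biUnion_subset.2 fun i _ => hFE i, ?_, ?_⟩
  · have h1 : (H.card : ℝ) ≤ ∑ i ∈ Finset.range (T + 1), ((F i).card : ℝ) := by
      exact_mod_cast Finset.card_biUnion_le
    have h2 : ((∑ i ∈ Finset.range (T + 1), (A i).card : ℕ) : ℝ) ≤ (2 * L * n : ℕ) := by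
      exact_mod_cast sum_range_le_of_add_two_mul_le hcard hcount (T + 1)
    push_cast at h2
    calc (H.card : ℝ) ≤ ∑ i ∈ Finset.range (T + 1), 4 * q * ((A i).card : ℝ) :=
          h1.trans (Finset.sum_le_sum fun i _ => hFc i)
      _ = 4 * q * ∑ i ∈ Finset.range (T + 1), ((A i).card : ℝ) := by rw [Finset.mul_sum]
      _ ≤ 4 * q * (2 * L * n) := by gcongr
      _ = _ := by ring
  · have key : ∀ i ≤ T, ∀ u ∈ S, ∀ v, rtdist E W u v ≤ ENNReal.ofReal (R i) →
        rtdist H W u v ≤ ENNReal.ofReal (18 * k) * rtdist E W u v := by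
      intro i
      induction i with
      | zero =>
        intro _ u _ v huv
        have : u = v := by
          by_contra h
          exact absurd (hsep u v h) (not_lt.2 (by simpa [hR0] using huv))
        simp [this, rtdist_self]
      | succ i ih =>
        intro hi u hu v huv
        rcases le_or_gt (rtdist E W u v) (ENNReal.ofReal (R i)) with hle | hgt
        · exact ih (by omega) u hu v hle
        have hdiam : ∀ x y, π (i + 1) x = π (i + 1) y →
            rtdist H W x y ≤ ENNReal.ofReal (γ (i + 1)) := fun x y hxy => by
          rw [← hδγ (i + 1)]
          refine rtdist_le_of_mk_eq (fun a ha b hab => ?_) hxy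
          have h1 := ih (by omega) a ha b (hab.trans (ENNReal.ofReal_le_ofReal (hδR i)))
          refine h1.trans ?_
          rw [ENNReal.ofReal_mul (p := 18 * k) (by positivity)]
          gcongr
        have hmain : rtdist H W u v ≤ ENNReal.ofReal (18 * k * R i) := by
          have hR2 := hRs i
          have hγi := hγR' (i + 1)
          have hRi := hR i
          by_cases hπuv : π (i + 1) u = π (i + 1) v
          · refine (hdiam u v hπuv).trans (ENNReal.ofReal_le_ofReal ?_)
            nlinarith
          · refine (hF (i + 1) H ?_ (fun x y hxy => le_self_add.trans (hdiam x y hxy)) u hu v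
              hπuv huv).trans (ENNReal.ofReal_le_ofReal ?_)
            · exact_mod_cast Finset.subset_biUnion_of_mem F (Finset.mem_range.2 (by omega))
            · rw [hγR]
              nlinarith
        refine hmain.trans ?_
        rw [ENNReal.ofReal_mul (by positivity)]
        gcongr
    intro u hu v
    by_cases htop : rtdist (E : Set (V × V)) W u v = ⊤
    · rw [htop, ENNReal.mul_top (by simpa using hk.ne')]
      exact le_top
    · exact key T le_rfl u hu v (hR0 T ▸ hT u v htop)

/-- The logarithmic number of levels after which neighbouring classes are merged. -/
theorem exists_level_count {n : ℕ} (hn : 2 ≤ n) :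
    ∃ L : ℕ, 108 * (n : ℝ) ^ 3 ≤ 2 ^ L ∧ (L : ℝ) ≤ 60 * Real.log n ^ 2 := by
  have hn2 : (2 : ℝ) ≤ n := by exact_mod_cast hn
  have hl2 : 0.69 < Real.log 2 := by linarith [Real.log_two_gt_d9]
  have hln : Real.log 2 ≤ Real.log n := Real.log_le_log (by norm_num) hn2
  have hx : Real.log n / Real.log 2 ≤ 1.45 * Real.log n := by
    rw [div_le_iff₀ (by linarith)]
    nlinarith
  let c := ⌈Real.log n / Real.log 2⌉₊
  have hc : (c : ℝ) ≤ 3 * Real.log n := by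
    have := Nat.ceil_lt_add_one (a := Real.log n / Real.log 2)
      (div_nonneg (by linarith) (by linarith))
    change (c : ℝ) < _ at this
    linarith
  have hnc : (n : ℝ) ≤ 2 ^ c := by
    have h1 : Real.log n / Real.log 2 ≤ c := Nat.le_ceil _
    rw [div_le_iff₀ (by linarith)] at h1
    rw [← Real.log_le_log_iff (by linarith) (by positivity), Real.log_pow]
    exact h1
  refine ⟨10 * c, ?_, ?_⟩
  · calc 108 * (n : ℝ) ^ 3 ≤ 2 ^ 7 * (n : ℝ) ^ 3 := by gcongr; norm_num
      _ ≤ (n : ℝ) ^ 7 * (n : ℝ) ^ 3 := by gcongr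
      _ = (n : ℝ) ^ 10 := by ring
      _ ≤ (2 ^ c) ^ 10 := by gcongr
      _ = 2 ^ (10 * c) := by rw [← pow_mul, mul_comm]
  · push_cast
    nlinarith

end Assembly

/-- **Improved source-wise round-trip spanners.**
There is an absolute constant `C > 0` such that for every weighted directed
graph `G = (V, E, W)` with `n ≥ 2` vertices and positive edge weights, every
source set `S ⊆ V` of size `s ≥ 2` and every integer `k > 1`, there is a
subgraph `H = (V, F, W)` of `G` with at most `C * n * s^(1/k) * (log n)^2`
edges that is an `S`-sourcewise `(C * k * log n)`-roundtrip spanner of `G`. -/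
theorem sourcewise_roundtrip_spanner :
    ∃ C : ℝ, 0 < C ∧
      ∀ (V : Type) [Fintype V] (E : Finset (V × V)) (W : V × V → ℝ),
        (∀ e ∈ E, 0 < W e) →
        2 ≤ Fintype.card V →
        ∀ S : Finset V, 2 ≤ S.card →
        ∀ k : ℕ, 1 < k →
        ∃ F : Finset (V × V), F ⊆ E ∧
          (F.card : ℝ) ≤
            C * (Fintype.card V : ℝ) * (S.card : ℝ) ^ ((1 : ℝ) / (k : ℝ)) *
              Real.log (Fintype.card V) ^ 2 ∧
          ∀ u ∈ S, ∀ v : V,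
            rtdist (↑F) W u v ≤
              ENNReal.ofReal (C * (k : ℝ) * Real.log (Fintype.card V)) *
                rtdist (↑E) W u v := by
  classical
  refine ⟨2000, by norm_num, ?_⟩
  intro V _ E W hW hV S hS k hk
  set n := Fintype.card V with hn
  have hn2 : (2 : ℝ) ≤ n := by exact_mod_cast hV
  have hln : 0.69 < Real.log n := by
    have := Real.log_le_log (by norm_num) hn2
    linarith [Real.log_two_gt_d9]
  have hs1 : (1 : ℝ) ≤ S.card := by exact_mod_cast (by omega : 1 ≤ S.card)
  have hsn : S.card ≤ n := Finset.card_le_univ S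
  have hroot : (1 : ℝ) ≤ (S.card : ℝ) ^ ((1 : ℝ) / k) :=
    Real.one_le_rpow hs1 (by positivity)
  obtain ⟨L, hL, hLlog⟩ := exists_level_count hV
  obtain ⟨k', q, hk'0, hk'k, hk'n, hq0, hqS, hq⟩ : ∃ (k' : ℕ) (q : ℝ), 0 < k' ∧ k' ≤ k ∧
      k' ≤ n ∧ 0 ≤ q ∧ 2 * (S.card : ℝ) ≤ q ^ k' ∧
      q ≤ 4 * (S.card : ℝ) ^ ((1 : ℝ) / k) := by
    rcases le_total k n with hkn | hkn
    · refine ⟨k, 2 * (S.card : ℝ) ^ ((1 : ℝ) / k), by omega, le_rfl, hkn, by positivity, ?_,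
        by linarith⟩
      rw [mul_pow, one_div, Real.rpow_inv_natCast_pow (by positivity) (by omega)]
      gcongr
      exact le_self_pow₀ one_le_two (by omega)
    · refine ⟨n, 4, by omega, hkn, le_rfl, by norm_num, ?_, by linarith⟩
      have h1 : n < 2 ^ n := Nat.lt_two_pow_self
      have h2 : 2 ≤ 2 ^ n := hV.trans h1.le
      have h3 : 2 * S.card ≤ 4 ^ n :=
        calc 2 * S.card ≤ 2 ^ n * 2 ^ n := Nat.mul_le_mul h2 (hsn.trans h1.le)
          _ = 4 ^ n := by rw [← mul_pow]; norm_num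
      exact_mod_cast h3
  obtain ⟨F, hFE, hFc, hF⟩ := exists_sourcewise_spanner E W hW hV S hq0 hk'0 hqS (L := L) (by
    refine le_trans ?_ hL
    have : (k' : ℝ) ≤ n := by exact_mod_cast hk'n
    calc 108 * (n : ℝ) ^ 2 * k' ≤ 108 * (n : ℝ) ^ 2 * n := by gcongr
      _ = _ := by ring)
  refine ⟨F, hFE, ?_, fun u hu v => (hF u hu v).trans ?_⟩
  · calc (F.card : ℝ) ≤ 8 * q * L * n := hFc
      _ ≤ 8 * (4 * (S.card : ℝ) ^ ((1 : ℝ) / k)) * (60 * Real.log n ^ 2) * n := by gcongr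
      _ = 1920 * (n * (S.card : ℝ) ^ ((1 : ℝ) / k) * Real.log n ^ 2) := by ring
      _ ≤ 2000 * (n * (S.card : ℝ) ^ ((1 : ℝ) / k) * Real.log n ^ 2) := by
          gcongr; norm_num
      _ = _ := by ring
  · gcongr ENNReal.ofReal ?_ * _
    have : (k' : ℝ) ≤ k := by exact_mod_cast hk'k
    have hk0 : (0 : ℝ) ≤ k := by positivity
    calc 18 * (k' : ℝ) ≤ 2000 * k * 0.69 := by linarith
      _ ≤ 2000 * k * Real.log n := by gcongr
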